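/- arXiv:quant-ph/0503239 — 5 statements merged into one kernel-verified Lean document; each statement's English description precedes it below -/
import Mathlib

section
/- Let n ≥ 2 and let B_0, B_1, ..., B_n be n+1 orthonormal bases of ℂ^n, with B_a = (v_{a,0}, ..., v_{a,n-1}), which are pairwise mutually unbiased, i.e. |⟨v_{a,b}, v_{c,d}⟩| = n^{-1/2} whenever a ≠ c. Then the n² rank-one matrices |v_{a,b}⟩⟨v_{a,b}| indexed by those pairs (a,b) with (a,b) = (0,0) or b ≠ 0 are linearly independent in the complex vector space of n×n matrices. -/
open scoped ComplexInnerProductSpace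

/-- The quadratic form of the rank-one matrix `|u⟩⟨u|`, evaluated at `w`. -/
lemma sum_conj_mul_rankOne_mul {ι : Type*} [Fintype ι] (u w : EuclideanSpace ℂ ι) :
    ∑ i, ∑ j, (starRingEnd ℂ) (w i) * (u i * (starRingEnd ℂ) (u j)) * w j =
      ((‖⟪u, w⟫‖ ^ 2 : ℝ) : ℂ) := by
  have hnorm : ((‖⟪u, w⟫‖ ^ 2 : ℝ) : ℂ) = ⟪w, u⟫ * ⟪u, w⟫ := by
    rw [← inner_conj_symm w u, Complex.conj_mul']
    push_cast
    rfl
  rw [hnorm, PiLp.inner_apply, PiLp.inner_apply, Finset.sum_mul_sum]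
  refine Finset.sum_congr rfl fun i _ => Finset.sum_congr rfl fun j _ => ?_
  simp only [RCLike.inner_apply]
  ring

/-- A linear relation between the projectors of mutually unbiased bases expresses each coefficient
through the coefficient sums of the other bases. -/
lemma coeff_add_sum_eq_zero_of_mub_relation {α β ι : Type*} [Fintype α] [DecidableEq α]
    [Fintype β] [Fintype ι] {v : α → β → EuclideanSpace ℂ ι} {r : ℝ}
    (horth : ∀ a, Orthonormal ℂ (v a))
    (hmub : ∀ a c, a ≠ c → ∀ b d, ‖⟪v a b, v c d⟫‖ = r) {l : α × β → ℂ}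
    (hl : ∑ x, l x • (Matrix.of fun i j => v x.1 x.2 i * (starRingEnd ℂ) (v x.1 x.2 j) :
      Matrix ι ι ℂ) = 0) (c : α) (d : β) :
    l (c, d) + ∑ a ∈ Finset.univ.erase c, (∑ b, l (a, b)) * (r : ℂ) ^ 2 = 0 := by
  classical
  have hpair : ∑ x : α × β, l x * ((‖⟪v x.1 x.2, v c d⟫‖ ^ 2 : ℝ) : ℂ) = 0 := by
    have h := congrArg (fun M : Matrix ι ι ℂ =>
      ∑ i, ∑ j, (starRingEnd ℂ) (v c d i) * M i j * v c d j) hl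
    simp only [Matrix.sum_apply, Matrix.smul_apply, Matrix.of_apply, Matrix.zero_apply, mul_zero,
      zero_mul, Finset.sum_const_zero, smul_eq_mul, Finset.mul_sum, Finset.sum_mul] at h
    rw [← h]
    simp_rw [← sum_conj_mul_rankOne_mul, Finset.mul_sum]
    rw [Finset.sum_comm]
    refine Finset.sum_congr rfl fun i _ => ?_
    rw [Finset.sum_comm]
    refine Finset.sum_congr rfl fun j _ => Finset.sum_congr rfl fun x _ => ?_
    ring
  rw [Fintype.sum_prod_type, ← Finset.add_sum_erase _ _ (Finset.mem_univ c)] at hpair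
  rw [← hpair]
  congr 1
  · rw [Finset.sum_eq_single d]
    · simp [(horth c).norm_eq_one]
    · intro b _ hb
      simp [(horth c).inner_eq_zero hb]
    · simp
  · refine Finset.sum_congr rfl fun a ha => ?_
    rw [Finset.sum_mul]
    refine Finset.sum_congr rfl fun b _ => ?_
    rw [hmub a c (Finset.ne_of_mem_erase ha)]
    push_cast
    rfl

/-- Given `n + 1` pairwise mutually unbiased orthonormal bases
`B_0, …, B_n` of `ℂ^n` (`n ≥ 2`), the `n²` rank-one matrices `|v_{a,b}⟩⟨v_{a,b}|`
indexed by the pairs `(a,b)` with `(a,b) = (0,0)` or `b ≠ 0` are linearly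
independent in the space of `n × n` complex matrices. -/
theorem mub_pruned_projectors_linearIndependent
    (n : ℕ) (hn : 2 ≤ n)
    (v : Fin (n + 1) → Fin n → EuclideanSpace ℂ (Fin n))
    (horth : ∀ a, Orthonormal ℂ (v a))
    (hbasis : ∀ a, Submodule.span ℂ (Set.range (v a)) = ⊤)
    (hmub : ∀ a c, a ≠ c → ∀ b d, ‖⟪v a b, v c d⟫‖ = 1 / Real.sqrt n) :
    LinearIndependent ℂ
      (fun x : {ab : Fin (n + 1) × Fin n // ab = (0, ⟨0, by omega⟩) ∨ ab.2 ≠ ⟨0, by omega⟩} =>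
        (Matrix.of fun i j => v x.1.1 x.1.2 i * (starRingEnd ℂ) (v x.1.1 x.1.2 j) :
          Matrix (Fin n) (Fin n) ℂ)) := by
  let s : Set (Fin (n + 1) × Fin n) := {ab | ab = (0, ⟨0, by omega⟩) ∨ ab.2 ≠ ⟨0, by omega⟩}
  let P : Fin (n + 1) × Fin n → Matrix (Fin n) (Fin n) ℂ := fun x =>
    Matrix.of fun i j => v x.1 x.2 i * (starRingEnd ℂ) (v x.1 x.2 j)
  change LinearIndepOn ℂ P s
  rw [linearIndepOn_iff]
  intro l hs hl
  rw [Finsupp.linearCombination_apply, Finsupp.sum_fintype _ _ (by simp)] at hl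
  have hrel := coeff_add_sum_eq_zero_of_mub_relation horth hmub hl
  have hne : ∀ a, a ≠ 0 → ∀ b, l (a, b) = 0 := by
    intro a ha b
    have hz : l (a, ⟨0, by omega⟩) = 0 := by
      by_contra h
      have hmem := (Finsupp.mem_supported ℂ l).mp hs (Finsupp.mem_support_iff.mpr h)
      simp [s, ha] at hmem
    have h := (hrel a b).trans (hrel a ⟨0, by omega⟩).symm
    rwa [add_left_inj, hz] at h
  ext ⟨a, b⟩
  by_cases ha : a = 0
  · subst ha
    have hsum := hrel 0 b
    rwa [Finset.sum_eq_zero, add_zero] at hsum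
    intro a ha
    simp [hne a (Finset.ne_of_mem_erase ha)]
  · exact hne a ha b
end

section
/- Let q = p^m be a power of an odd prime p. For a, b ∈ F_q define ψ_{a,b} = q^{-1/2} · (e_p(Tr_{F_q/F_p}(a x² + b x)))_{x ∈ F_q} ∈ ℂ^{F_q}. Then: (i) for each fixed a ∈ F_q, the set {ψ_{a,b} : b ∈ F_q} is an orthonormal basis of ℂ^{F_q}; (ii) for all a, c ∈ F_q with a ≠ c and all b, d ∈ F_q, |⟨ψ_{a,b}, ψ_{c,d}⟩| = q^{-1/2}; (iii) every ψ_{a,b} has inner product of absolute value q^{-1/2} with every standard basis vector of ℂ^{F_q}. Hence the standard basis together with the q bases {ψ_{a,b} : b ∈ F_q}, a ∈ F_q, form q+1 mutually unbiased bases of ℂ^q. -/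
open scoped ComplexInnerProductSpace

/-- `e_m(z) = exp(2 π i z / m)` for `z ∈ ZMod m` (represented by an integer in `[0, m-1]`). -/
noncomputable def eZMod (m : ℕ) (z : ZMod m) : ℂ :=
  Complex.exp (2 * Real.pi * Complex.I * (z.val : ℂ) / m)

/-- The standard additive character of `ZMod p` composed with the trace is primitive. -/
theorem isPrimitive_stdAddChar_trace (p : ℕ) [Fact p.Prime] (F : Type*) [Field F] [Finite F]
    [Algebra (ZMod p) F] :
    ((ZMod.stdAddChar (N := p)).compAddMonoidHom
      (Algebra.trace (ZMod p) F).toAddMonoidHom).IsPrimitive := by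
  apply AddChar.IsPrimitive.of_ne_one
  intro h
  obtain ⟨x, hx⟩ := Algebra.trace_surjective (ZMod p) F 1
  have h1 := DFunLike.congr_fun h x
  rw [AddChar.compAddMonoidHom_apply] at h1
  simp only [LinearMap.toAddMonoidHom_coe, hx, AddChar.one_apply] at h1
  rw [← (ZMod.stdAddChar (N := p)).map_zero_eq_one] at h1
  exact one_ne_zero (ZMod.injective_stdAddChar h1)

/-- A quadratic Gauss sum over a finite field of odd characteristic has absolute value `√q`. -/
theorem norm_sum_quadratic_addChar {F : Type*} [Field F] [Fintype F] (φ : AddChar F ℂ)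
    (hφ : φ.IsPrimitive) (h2 : (2 : F) ≠ 0) {α : F} (hα : α ≠ 0) (β : F) :
    ‖∑ x, φ (α * x ^ 2 + β * x)‖ = Real.sqrt (Fintype.card F) := by
  classical
  rw [eq_comm, Real.sqrt_eq_iff_eq_sq (by positivity) (norm_nonneg _)]
  have key : (∑ x, φ (α * x ^ 2 + β * x)) * (starRingEnd ℂ) (∑ y, φ (α * y ^ 2 + β * y)) =
      Fintype.card F := by
    calc _ = ∑ y, ∑ x, φ (α * x ^ 2 + β * x) * φ (-(α * y ^ 2 + β * y)) := by
          simp_rw [map_sum, ← AddChar.map_neg_eq_conj, Finset.sum_mul_sum]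
          exact Finset.sum_comm
      _ = ∑ y, ∑ h, φ (α * h ^ 2 + β * h) * φ (y * (2 * α * h)) := by
          refine Finset.sum_congr rfl fun y _ => ?_
          rw [← Equiv.sum_comp (Equiv.addLeft y)]
          refine Finset.sum_congr rfl fun h _ => ?_
          rw [← AddChar.map_add_eq_mul, ← AddChar.map_add_eq_mul]
          congr 1
          simp only [Equiv.coe_addLeft]
          ring
      _ = ∑ h, φ (α * h ^ 2 + β * h) * ∑ y, φ (y * (2 * α * h)) := by
          rw [Finset.sum_comm]
          simp_rw [Finset.mul_sum]
      _ = Fintype.card F := by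
          simp_rw [AddChar.sum_mulShift _ hφ]
          simp [h2, hα]
  rw [Complex.mul_conj, Complex.normSq_eq_norm_sq] at key
  exact_mod_cast key.symm

/-- For `q = p^m` a power of an odd prime `p` and
`ψ_{a,b} = q^{-1/2} (e_p(Tr_{F_q/F_p}(a x² + b x)))_{x ∈ F_q}`:
(i) for each `a`, `{ψ_{a,b} : b ∈ F_q}` is an orthonormal basis of `ℂ^{F_q}`;
(ii) for `a ≠ c`, `|⟨ψ_{a,b}, ψ_{c,d}⟩| = q^{-1/2}`;
(iii) each `ψ_{a,b}` has inner product of absolute value `q^{-1/2}` with each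
standard basis vector.  Hence the standard basis together with these `q` bases
form `q + 1` mutually unbiased bases of `ℂ^q`. -/
theorem mubs_from_gauss_sums
    (p m : ℕ) (hp : p.Prime) (hodd : p ≠ 2) (hm : 0 < m)
    (F : Type) [Field F] [Fintype F] [DecidableEq F] [Algebra (ZMod p) F]
    (hcard : Fintype.card F = p ^ m)
    (ψ : F → F → EuclideanSpace ℂ F)
    (hψ : ∀ a b x, ψ a b x =
      (1 / Real.sqrt (p ^ m) : ℝ) *
        eZMod p (Algebra.trace (ZMod p) F (a * x ^ 2 + b * x))) :
    (∀ a, Orthonormal ℂ (ψ a) ∧ Submodule.span ℂ (Set.range (ψ a)) = ⊤) ∧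
    (∀ a c, a ≠ c → ∀ b d, ‖⟪ψ a b, ψ c d⟫‖ = 1 / Real.sqrt (p ^ m)) ∧
    (∀ a b x, ‖⟪(EuclideanSpace.single x 1 : EuclideanSpace ℂ F), ψ a b⟫‖ =
      1 / Real.sqrt (p ^ m)) := by
  have : Fact p.Prime := ⟨hp⟩
  have h2 : (2 : F) ≠ 0 := by
    have : CharP F p := charP_of_injective_algebraMap (algebraMap (ZMod p) F).injective p
    exact Ring.two_ne_zero (by rwa [ringChar.eq F p])
  have hq : (0 : ℝ) < p ^ m := by have := hp.pos; positivity
  have hqc : (Fintype.card F : ℝ) = p ^ m := by exact_mod_cast hcard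
  obtain ⟨φ, hφ, hφe⟩ : ∃ φ : AddChar F ℂ, φ.IsPrimitive ∧
      ∀ x, eZMod p (Algebra.trace (ZMod p) F x) = φ x :=
    ⟨_, isPrimitive_stdAddChar_trace p F, fun x => (ZMod.toCircle_apply _).symm⟩
  simp_rw [hφe] at hψ
  have hsq : (1 / Real.sqrt (p ^ m)) * (1 / Real.sqrt (p ^ m)) = 1 / (p ^ m : ℝ) := by
    rw [div_mul_div_comm, Real.mul_self_sqrt hq.le, one_mul]
  have hinner : ∀ a b c d, ⟪ψ a b, ψ c d⟫ =
      ((1 / (p ^ m : ℝ) : ℝ) : ℂ) * ∑ x, φ ((c - a) * x ^ 2 + (d - b) * x) := by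
    intro a b c d
    rw [PiLp.inner_apply, Finset.mul_sum]
    refine Finset.sum_congr rfl fun x _ => ?_
    have hx : φ ((c - a) * x ^ 2 + (d - b) * x) =
        φ (c * x ^ 2 + d * x) * φ (-(a * x ^ 2 + b * x)) := by
      rw [← AddChar.map_add_eq_mul]
      congr 1
      ring
    rw [RCLike.inner_apply, hψ, hψ, map_mul, Complex.conj_ofReal, ← AddChar.map_neg_eq_conj,
      hx, ← hsq, Complex.ofReal_mul]
    ring
  refine ⟨fun a => ?_, fun a c hac b d => ?_, fun a b x => ?_⟩
  · have hon : Orthonormal ℂ (ψ a) := by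
      rw [orthonormal_iff_ite]
      intro b d
      rw [hinner]
      simp_rw [sub_self, zero_mul, zero_add, mul_comm (d - b)]
      rw [AddChar.sum_mulShift _ hφ]
      simp only [sub_eq_zero, eq_comm (a := d)]
      split_ifs
      · rw [← Complex.ofReal_natCast, ← Complex.ofReal_mul, hqc, one_div_mul_cancel hq.ne',
          Complex.ofReal_one]
      · simp
    exact ⟨hon, hon.linearIndependent.span_eq_top_of_card_eq_finrank' (by simp)⟩
  · rw [hinner, norm_mul, norm_sum_quadratic_addChar φ hφ h2 (sub_ne_zero.mpr hac.symm), hqc,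
      Complex.norm_real, Real.norm_of_nonneg (by positivity), ← hsq, mul_assoc,
      one_div_mul_cancel (Real.sqrt_pos.mpr hq).ne', mul_one]
  · rw [EuclideanSpace.inner_single_left, hψ, map_one, one_mul, norm_mul, AddChar.norm_apply,
      Complex.norm_real, Real.norm_of_nonneg (by positivity), mul_one]
end

section
/- Let q = p^m be a power of an odd prime p. For a ∈ F_q and b ∈ F_q with b ≠ 0 let ψ_{a,b} = q^{-1/2} · (e_p(Tr_{F_q/F_p}(a x² + b x)))_{x ∈ F_q} ∈ ℂ^{F_q}, and for a ∈ F_q let ψ_{a,0} = (δ_{a,x})_{x ∈ F_q} be the standard basis vector indexed by a. Set E_{a,b} = |ψ_{a,b}⟩⟨ψ_{a,b}| / q and G = Σ_{a ∈ F_q} Σ_{b ∈ F_q} E_{a,b}. Then G = I_q − (1/q) Q + (1/q) |e_0⟩⟨e_0|, where Q = Σ_{x ∈ F_q} |e_x⟩⟨e_{−x}| is the permutation matrix of the map x ↦ −x on F_q and e_x denotes the standard basis vector indexed by x ∈ F_q. Equivalently, ⟨e_x, G e_x⟩ = 1 for all x, ⟨e_x, G e_{−x}⟩ = −1/q for x ≠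 0, and ⟨e_x, G e_y⟩ = 0 whenever x ≠ ±y. -/
/-- The additive character `x ↦ e_p(Tr x)` of a finite extension `F` of `ZMod p`. -/
noncomputable def traceChar (p : ℕ) [NeZero p] (F : Type*) [CommRing F] [Algebra (ZMod p) F] :
    AddChar F ℂ :=
  (ZMod.stdAddChar (N := p)).compAddMonoidHom (Algebra.trace (ZMod p) F).toAddMonoidHom

lemma stdAddChar_eq_eZMod (m : ℕ) [NeZero m] (z : ZMod m) : ZMod.stdAddChar z = eZMod m z := by
  rw [ZMod.stdAddChar_apply, ZMod.toCircle_apply, eZMod, mul_div_assoc]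

lemma traceChar_apply (p : ℕ) [NeZero p] {F : Type*} [CommRing F] [Algebra (ZMod p) F] (x : F) :
    traceChar p F x = eZMod p (Algebra.trace (ZMod p) F x) :=
  stdAddChar_eq_eZMod p _

lemma traceChar_isPrimitive (p : ℕ) [Fact p.Prime] (F : Type*) [Field F] [Finite F]
    [Algebra (ZMod p) F] : (traceChar p F).IsPrimitive := by
  apply AddChar.IsPrimitive.of_ne_one
  intro h
  obtain ⟨x, hx⟩ := Algebra.trace_surjective (ZMod p) F 1
  have h1 : ZMod.stdAddChar (N := p) (Algebra.trace (ZMod p) F x) = 1 := DFunLike.congr_fun h x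
  rw [hx, ← AddChar.map_zero_eq_one (ZMod.stdAddChar (N := p))] at h1
  exact one_ne_zero (ZMod.injective_stdAddChar h1)

/-- Sum of `χ (a u + b v)` over all `a` and all nonzero `b`. -/
lemma AddChar.IsPrimitive.sum_sum_erase_zero {F : Type*} [Field F] [Fintype F] [DecidableEq F]
    {χ : AddChar F ℂ} (hχ : χ.IsPrimitive) (u v : F) :
    ∑ a, ∑ b ∈ Finset.univ.erase 0, χ (a * u + b * v) =
      (if u = 0 then (Fintype.card F : ℂ) else 0) *
        ((if v = 0 then (Fintype.card F : ℂ) else 0) - 1) := by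
  have hv : ∑ b ∈ Finset.univ.erase 0, χ (b * v) =
      (if v = 0 then (Fintype.card F : ℂ) else 0) - 1 := by
    rw [Finset.sum_erase_eq_sub (Finset.mem_univ _), AddChar.sum_mulShift v hχ]
    simp
  have hu := AddChar.sum_mulShift u hχ
  push_cast at hu
  simp_rw [AddChar.map_add_eq_mul, ← Finset.mul_sum, hv, ← Finset.sum_mul, hu]

/-- For `q = p^m` a power of an odd prime, with
`ψ_{a,b} = q^{-1/2}(e_p(Tr(a x² + b x)))_x` for `b ≠ 0`, `ψ_{a,0} = e_a` the
standard basis vector, `E_{a,b} = |ψ_{a,b}⟩⟨ψ_{a,b}|/q` and `G = Σ_{a,b} E_{a,b}`,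
one has `G = I − (1/q) Q + (1/q)|e_0⟩⟨e_0|` where `Q` is the permutation matrix of
`x ↦ −x`; equivalently `G x x = 1`, `G x (−x) = −1/q` for `x ≠ 0`, and `G x y = 0`
for `x ≠ ±y`. -/
theorem frame_operator_of_pruned_mubs
    (p m : ℕ) (hp : p.Prime) (hodd : p ≠ 2) (hm : 0 < m)
    (F : Type) [Field F] [Fintype F] [DecidableEq F] [Algebra (ZMod p) F]
    (hcard : Fintype.card F = p ^ m)
    (ψ : F → F → EuclideanSpace ℂ F)
    (hψ : ∀ a b, b ≠ 0 → ∀ x, ψ a b x =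
      (1 / Real.sqrt (p ^ m) : ℝ) *
        eZMod p (Algebra.trace (ZMod p) F (a * x ^ 2 + b * x)))
    (hψ0 : ∀ a x, ψ a 0 x = if x = a then 1 else 0)
    (E : F → F → Matrix F F ℂ)
    (hE : ∀ a b, E a b = ((p : ℂ) ^ m)⁻¹ •
      (Matrix.of fun x y => ψ a b x * (starRingEnd ℂ) (ψ a b y)))
    (G : Matrix F F ℂ) (hG : G = ∑ a : F, ∑ b : F, E a b)
    (Q : Matrix F F ℂ) (hQ : Q = Matrix.of fun x y => if y = -x then 1 else 0) :
    (G = 1 - ((p : ℂ) ^ m)⁻¹ • Q +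
        ((p : ℂ) ^ m)⁻¹ • (Matrix.of fun x y => if x = 0 ∧ y = 0 then 1 else 0)) ∧
    (∀ x : F, G x x = 1) ∧
    (∀ x : F, x ≠ 0 → G x (-x) = -((p : ℂ) ^ m)⁻¹) ∧
    (∀ x y : F, x ≠ y → x ≠ -y → G x y = 0) := by
  have : Fact p.Prime := ⟨hp⟩
  have hq : ((p : ℂ) ^ m) ≠ 0 := pow_ne_zero _ (Nat.cast_ne_zero.2 hp.ne_zero)
  have hcardC : (Fintype.card F : ℂ) = (p : ℂ) ^ m := by rw [hcard, Nat.cast_pow]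
  have hsqrt : ((1 / Real.sqrt (p ^ m) : ℝ) : ℂ) * ((1 / Real.sqrt (p ^ m) : ℝ) : ℂ) =
      ((p : ℂ) ^ m)⁻¹ := by
    rw [← Complex.ofReal_mul, div_mul_div_comm, Real.mul_self_sqrt (by positivity)]
    simp
  have hψψ : ∀ x y a b, b ≠ 0 → ψ a b x * (starRingEnd ℂ) (ψ a b y) =
      ((p : ℂ) ^ m)⁻¹ * traceChar p F (a * (x ^ 2 - y ^ 2) + b * (x - y)) := by
    intro x y a b hb
    rw [hψ a b hb, hψ a b hb, ← traceChar_apply, ← traceChar_apply, map_mul, Complex.conj_ofReal,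
      ← AddChar.map_neg_eq_conj, mul_mul_mul_comm, hsqrt, ← AddChar.map_add_eq_mul]
    ring_nf
  have hGxy : ∀ x y, G x y = ((p : ℂ) ^ m)⁻¹ * ((if x = y then 1 else 0) + ((p : ℂ) ^ m)⁻¹ *
      ((if x ^ 2 - y ^ 2 = 0 then (p : ℂ) ^ m else 0) *
        ((if x - y = 0 then (p : ℂ) ^ m else 0) - 1))) := by
    intro x y
    have hsum := (traceChar_isPrimitive p F).sum_sum_erase_zero (x ^ 2 - y ^ 2) (x - y)
    rw [hcardC] at hsum
    rw [hG, ← hsum]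
    simp_rw [Matrix.sum_apply, hE, Matrix.smul_apply, Matrix.of_apply, smul_eq_mul,
      ← Finset.mul_sum]
    congr 1
    rw [Finset.mul_sum]
    have hdiag : (if x = y then (1 : ℂ) else 0) =
        ∑ a, ψ a 0 x * (starRingEnd ℂ) (ψ a 0 y) := by
      simp [hψ0]
    rw [hdiag, ← Finset.sum_add_distrib]
    refine Finset.sum_congr rfl fun a _ => ?_
    rw [← Finset.add_sum_erase _ _ (Finset.mem_univ (0 : F)), Finset.mul_sum]
    congr 1
    exact Finset.sum_congr rfl fun b hb => hψψ x y a b (Finset.ne_of_mem_erase hb)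
  have h2 : (2 : F) ≠ 0 := by
    have : CharP F p := charP_of_injective_algebraMap (algebraMap (ZMod p) F).injective p
    exact Ring.two_ne_zero (by rwa [ringChar.eq F p])
  have hneg : ∀ x : F, x ≠ 0 → x ≠ -x := by
    intro x hx h
    have : 2 * x = 0 := by linear_combination h
    exact (mul_ne_zero h2 hx) this
  have hself : ∀ x : F, G x x = 1 := by
    intro x
    rw [hGxy]
    simp [hq]
  have hanti : ∀ x : F, x ≠ 0 → G x (-x) = -((p : ℂ) ^ m)⁻¹ := by
    intro x hx
    rw [hGxy, if_neg (hneg x hx), if_pos (by ring), if_neg (sub_ne_zero.2 (hneg x hx))]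
    field_simp
    ring
  have hzero : ∀ x y : F, x ≠ y → x ≠ -y → G x y = 0 := by
    intro x y h h'
    have : x ^ 2 - y ^ 2 ≠ 0 := fun h0 => (sq_eq_sq_iff_eq_or_eq_neg.1 (sub_eq_zero.1 h0)).elim h h'
    simp [hGxy, h, this]
  refine ⟨?_, hself, hanti, hzero⟩
  ext x y
  simp only [hQ, Matrix.add_apply, Matrix.sub_apply, Matrix.smul_apply, Matrix.of_apply,
    Matrix.one_apply, smul_eq_mul]
  by_cases hxy : x = y
  · subst hxy
    rw [hself]
    by_cases hx : x = 0
    · simp [hx]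
    · simp [hx, hneg x hx]
  · by_cases hxy' : y = -x
    · subst hxy'
      have hx : x ≠ 0 := by
        rintro rfl
        simp at hxy
      rw [hanti x hx]
      simp [hx, hxy]
    · have h0 : ¬(x = 0 ∧ y = 0) := fun h => hxy (h.1.trans h.2.symm)
      rw [hzero x y hxy fun h => hxy' (by rw [h, neg_neg])]
      simp [hxy, hxy', h0]
end

section
/- Let q = p^m be a power of an odd prime p. For a ∈ F_q and b ∈ F_q with b ≠ 0 let ψ_{a,b} = q^{-1/2} · (e_p(Tr_{F_q/F_p}(a x² + b x)))_{x ∈ F_q} ∈ ℂ^{F_q}, and for a ∈ F_q let ψ_{a,0} be the standard basis vector indexed by a. Let E_{a,b} = |ψ_{a,b}⟩⟨ψ_{a,b}| / q, G = Σ_{a,b ∈ F_q} E_{a,b}, and F_{a,b} = G^{-1/2} E_{a,b} G^{-1/2}. Then G is positive definite, Σ_{a,b ∈ F_q} F_{a,b} = I_q (so the F_{a,b} form a POVM with q² elements), and the q² matrices F_{a,b} are linearly independent (informational completeness). -/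
open scoped ComplexOrder

theorem eZMod_eq_stdAddChar (p : ℕ) [NeZero p] (z : ZMod p) :
    eZMod p z = ZMod.stdAddChar z := by
  rw [ZMod.stdAddChar_apply, ZMod.toCircle_apply, eZMod]

/-- The canonical additive character `x ↦ e_p(Tr x)` of a finite field. -/
noncomputable def traceAddChar (p : ℕ) [NeZero p] (F : Type*) [CommRing F] [Algebra (ZMod p) F] :
    AddChar F ℂ :=
  (ZMod.stdAddChar (N := p)).compAddMonoidHom (Algebra.trace (ZMod p) F).toAddMonoidHom

theorem traceAddChar_apply (p : ℕ) [NeZero p] (F : Type*) [CommRing F] [Algebra (ZMod p) F]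
    (x : F) : traceAddChar p F x = eZMod p (Algebra.trace (ZMod p) F x) := by
  rw [eZMod_eq_stdAddChar]
  rfl

theorem isPrimitive_traceAddChar (p : ℕ) [Fact p.Prime] (F : Type*) [Field F] [Finite F]
    [Algebra (ZMod p) F] : (traceAddChar p F).IsPrimitive := by
  refine AddChar.IsPrimitive.of_ne_one fun h => ?_
  obtain ⟨x, hx⟩ := Algebra.trace_surjective (ZMod p) F 1
  have h1 : traceAddChar p F x = 1 := by rw [h, AddChar.one_apply]
  rw [traceAddChar_apply, eZMod_eq_stdAddChar, hx,
    ← AddChar.map_zero_eq_one (ZMod.stdAddChar (N := p))] at h1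
  exact one_ne_zero (ZMod.injective_stdAddChar h1)

/-- Fourier inversion over a finite field. -/
theorem AddChar.IsPrimitive.fourier_inversion {F : Type*} [Field F] [Fintype F]
    {χ : AddChar F ℂ} (hχ : χ.IsPrimitive) (f : F → ℂ) (b : F) :
    ∑ t, (∑ a, f a * χ (a * t)) * χ (-(b * t)) = Fintype.card F * f b := by
  classical
  calc ∑ t, (∑ a, f a * χ (a * t)) * χ (-(b * t))
      = ∑ a, f a * ∑ t, χ (t * (a - b)) := by
        simp_rw [Finset.sum_mul, Finset.mul_sum]
        rw [Finset.sum_comm]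
        refine Finset.sum_congr rfl fun a _ => Finset.sum_congr rfl fun t _ => ?_
        rw [mul_assoc, ← AddChar.map_add_eq_mul]
        congr 2
        ring
    _ = Fintype.card F * f b := by
        simp [AddChar.sum_mulShift _ hχ, sub_eq_zero, mul_comm]

/-- Coefficients vanishing on `b = 0` are determined by the off-diagonal values of the
corresponding combination of the kernels `χ (a * (x ^ 2 - y ^ 2) + b * (x - y))`. -/
theorem AddChar.IsPrimitive.eq_zero_of_offDiag {F : Type*} [Field F] [Fintype F]
    {χ : AddChar F ℂ} (hχ : χ.IsPrimitive) (h2 : (2 : F) ≠ 0) (c : F → F → ℂ)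
    (hc : ∀ a, c a 0 = 0)
    (h : ∀ x y, x ≠ y → ∑ a, ∑ b, c a b * χ (a * (x ^ 2 - y ^ 2) + b * (x - y)) = 0)
    (a b : F) : c a b = 0 := by
  have hq : (Fintype.card F : ℂ) ≠ 0 := Nat.cast_ne_zero.mpr Fintype.card_ne_zero
  have hH : ∀ s t : F, s ≠ 0 → ∑ a, (∑ b, c a b * χ (b * s)) * χ (a * t) = 0 := by
    intro s t hs
    have key := h ((t / s + s) / 2) ((t / s - s) / 2) fun he => hs <| by
      have : (t / s + s) / 2 - (t / s - s) / 2 = s := by field_simp; ring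
      rw [← this, he, sub_self]
    rw [← key]
    refine Finset.sum_congr rfl fun a _ => ?_
    rw [Finset.sum_mul]
    refine Finset.sum_congr rfl fun b _ => ?_
    rw [mul_assoc, ← AddChar.map_add_eq_mul]
    congr 2
    field_simp
    ring
  have hK : ∀ s : F, s ≠ 0 → ∑ b, c a b * χ (b * s) = 0 := by
    intro s hs
    have := hχ.fourier_inversion (fun a => ∑ b, c a b * χ (b * s)) a
    simp only [hH s _ hs, zero_mul, Finset.sum_const_zero] at this
    exact (mul_eq_zero.mp this.symm).resolve_left hq
  have hconst : ∀ d, Fintype.card F * c a d = ∑ b, c a b := by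
    intro d
    rw [← hχ.fourier_inversion (c a) d, Finset.sum_eq_single 0]
    · simp
    · intro s _ hs
      rw [hK s hs, zero_mul]
    · simp
  have := hconst b
  rw [← hconst 0, hc, mul_zero] at this
  exact (mul_eq_zero.mp this).resolve_left hq

/-- Congruence by an invertible matrix preserves linear independence. -/
theorem LinearIndependent.matrix_mul_mul {ι n R : Type*} [Fintype n] [DecidableEq n] [CommRing R]
    {v : ι → Matrix n n R} (hv : LinearIndependent R v) {S T : Matrix n n R}
    (hS : IsUnit S) (hT : IsUnit T) : LinearIndependent R fun i => S * v i * T :=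
  hv.map' (LinearMap.mulRight R T ∘ₗ LinearMap.mulLeft R S) <| LinearMap.ker_eq_bot.mpr
    (hT.mul_left_injective.comp hS.mul_right_injective)


/-- With the pruned-MUB vectors `ψ_{a,b}` in dimension `q = p^m`
(`p` an odd prime), `E_{a,b} = |ψ_{a,b}⟩⟨ψ_{a,b}|/q`, `G = Σ E_{a,b}` and
`F_{a,b} = G^{-1/2} E_{a,b} G^{-1/2}`: `G` is positive definite, `Σ F_{a,b} = I`
(POVM/completeness), and the `q²` matrices `F_{a,b}` are linearly independent
(informational completeness). -/
theorem asic_povm_completeness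
    (p m : ℕ) (hp : p.Prime) (hodd : p ≠ 2) (hm : 0 < m)
    (F : Type) [Field F] [Fintype F] [DecidableEq F] [Algebra (ZMod p) F]
    (hcard : Fintype.card F = p ^ m)
    (ψ : F → F → EuclideanSpace ℂ F)
    (hψ : ∀ a b, b ≠ 0 → ∀ x, ψ a b x =
      (1 / Real.sqrt (p ^ m) : ℝ) *
        eZMod p (Algebra.trace (ZMod p) F (a * x ^ 2 + b * x)))
    (hψ0 : ∀ a x, ψ a 0 x = if x = a then 1 else 0)
    (E : F → F → Matrix F F ℂ)
    (hE : ∀ a b, E a b = ((p : ℂ) ^ m)⁻¹ •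
      (Matrix.of fun x y => ψ a b x * (starRingEnd ℂ) (ψ a b y)))
    (G : Matrix F F ℂ) (hG : G = ∑ a : F, ∑ b : F, E a b) :
    G.PosDef ∧
    ∀ S : Matrix F F ℂ, S.PosDef → S * S = G →
      (∑ a : F, ∑ b : F, S⁻¹ * E a b * S⁻¹ = 1) ∧
      LinearIndependent ℂ (fun ab : F × F => S⁻¹ * E ab.1 ab.2 * S⁻¹) := by
  have : Fact p.Prime := ⟨hp⟩
  have hq : (0 : ℂ) < ((p : ℂ) ^ m)⁻¹ :=
    inv_pos.mpr (pow_pos (Nat.cast_pos.mpr hp.pos) m)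
  have h2 : (2 : F) ≠ 0 := by
    have : CharP F p := charP_of_injective_algebraMap (algebraMap (ZMod p) F).injective p
    exact Ring.two_ne_zero (by rwa [ringChar.eq F p])
  have hpsd : ∀ a b, (E a b).PosSemidef := fun a b => by
    rw [hE]
    exact (Matrix.posSemidef_vecMulVec_self_star (ψ a b).ofLp).smul hq.le
  have hE0 : ∑ a, E a 0 = ((p : ℂ) ^ m)⁻¹ • (1 : Matrix F F ℂ) := by
    ext x y
    simp only [hE, ← Finset.smul_sum, Matrix.smul_apply, Matrix.sum_apply, Matrix.of_apply, hψ0,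
      Matrix.one_apply]
    simp
  have hGpos : G.PosDef := by
    have hsplit : G = ∑ a, E a 0 + ∑ a, ∑ b ∈ Finset.univ.erase 0, E a b := by
      rw [hG, ← Finset.sum_add_distrib]
      exact Finset.sum_congr rfl fun a _ =>
        (Finset.add_sum_erase _ _ (Finset.mem_univ 0)).symm
    rw [hsplit, hE0]
    exact (Matrix.PosDef.one.smul hq).add_posSemidef
      (Matrix.posSemidef_sum _ fun a _ => Matrix.posSemidef_sum _ fun b _ => hpsd a b)
  have hEb : ∀ a b x y, b ≠ 0 → E a b x y = ((p : ℂ) ^ m)⁻¹ * ((p : ℂ) ^ m)⁻¹ *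
      traceAddChar p F (a * (x ^ 2 - y ^ 2) + b * (x - y)) := by
    intro a b x y hb
    have hsqrt : ((1 / Real.sqrt (p ^ m) : ℝ) : ℂ) * ((1 / Real.sqrt (p ^ m) : ℝ) : ℂ) =
        ((p : ℂ) ^ m)⁻¹ := by
      rw [← Complex.ofReal_mul, div_mul_div_comm, Real.mul_self_sqrt (by positivity)]
      simp
    have harg : a * (x ^ 2 - y ^ 2) + b * (x - y) =
        (a * x ^ 2 + b * x) + -(a * y ^ 2 + b * y) := by ring
    rw [hE, Matrix.smul_apply, Matrix.of_apply, hψ a b hb, hψ a b hb, ← traceAddChar_apply,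
      ← traceAddChar_apply, map_mul, Complex.conj_ofReal, harg,
      AddChar.map_add_eq_mul _ (a * x ^ 2 + b * x),
      AddChar.map_neg_eq_conj, smul_eq_mul, ← hsqrt]
    ring
  have hE0diag : ∀ a x y, E a 0 x y = if x = a ∧ y = a then ((p : ℂ) ^ m)⁻¹ else 0 := by
    intro a x y
    rw [hE, Matrix.smul_apply, Matrix.of_apply, hψ0, hψ0]
    by_cases hx : x = a <;> by_cases hy : y = a <;> simp [hx, hy]
  have hind : LinearIndependent ℂ fun ab : F × F => E ab.1 ab.2 := by
    rw [Fintype.linearIndependent_iff]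
    intro g hg
    have hentry : ∀ x y, ∑ a, ∑ b, g (a, b) * E a b x y = 0 := fun x y => by
      have := congrFun (congrFun hg x) y
      rw [Fintype.sum_prod_type] at this
      simpa [Matrix.sum_apply] using this
    have hne : ∀ a b, b ≠ 0 → g (a, b) = 0 := by
      intro a b hb
      have := (isPrimitive_traceAddChar p F).eq_zero_of_offDiag h2
        (fun a b => if b = 0 then 0 else g (a, b)) (fun _ => if_pos rfl) (fun x y hxy => ?_) a b
      · simpa [hb] using this
      · have hz : ((p : ℂ) ^ m)⁻¹ * ((p : ℂ) ^ m)⁻¹ ≠ 0 := mul_ne_zero hq.ne' hq.ne'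
        refine (mul_eq_zero.mp ?_).resolve_left hz
        refine Eq.trans ?_ (hentry x y)
        rw [Finset.mul_sum]
        refine Finset.sum_congr rfl fun a _ => ?_
        rw [Finset.mul_sum]
        refine Finset.sum_congr rfl fun b _ => ?_
        by_cases hb : b = 0
        · subst hb
          have : ¬(x = a ∧ y = a) := fun h => hxy (h.1.trans h.2.symm)
          simp [hE0diag, this]
        · rw [hEb a b x y hb, if_neg hb]
          ring
    rintro ⟨a, b⟩
    by_cases hb : b = 0
    · subst hb
      have h0 := hentry a a
      rw [Finset.sum_eq_single a, Finset.sum_eq_single 0, hE0diag, if_pos ⟨rfl, rfl⟩] at h0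
      · exact (mul_eq_zero.mp h0).resolve_right hq.ne'
      · intro b _ hb
        rw [hne a b hb, zero_mul]
      · simp
      · intro d _ hd
        refine Finset.sum_eq_zero fun b _ => ?_
        by_cases hb : b = 0
        · subst hb
          simp [hE0diag, hd.symm]
        · rw [hne d b hb, zero_mul]
      · simp
    · exact hne a b hb
  refine ⟨hGpos, fun S hS hSG => ⟨?_, ?_⟩⟩
  · have hdet : IsUnit S.det := (Matrix.isUnit_iff_isUnit_det S).mp hS.isUnit
    simp_rw [← Finset.sum_mul, ← Finset.mul_sum]
    rw [← hG, ← hSG, Matrix.nonsing_inv_mul_cancel_left _ _ hdet, Matrix.mul_nonsing_inv _ hdet]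
  · have hS' : IsUnit S⁻¹ := hS.inv.isUnit
    exact hind.matrix_mul_mul hS' hS'
end

section
/- Let p be an odd prime and let 0 < r < 1 be a real number. For a, b ∈ {0, 1, ..., p−1} define φ_{a,b} = c_a · (r^{a·x} e_p(a x² + b x))_{x=0}^{p−1} ∈ ℂ^p, where c_a = (Σ_{x=0}^{p−1} r^{2 a x})^{-1/2} (so c_a = √((1−r^{2a})/(1−r^{2pa})) for a ≠ 0 and c_0 = p^{-1/2}); here a·x denotes the integer product and e_p(a x² + b x) depends only on a x² + b x mod p. Then the p² matrices E_{a,b} = |φ_{a,b}⟩⟨φ_{a,b}| / p are linearly independent in the space of p×p complex matrices. -/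
/-- `e_m(z) = exp(2 π i z / m)` for an integer `z`. -/
noncomputable def eInt (m : ℕ) (z : ℤ) : ℂ :=
  Complex.exp (2 * Real.pi * Complex.I * (z : ℂ) / m)

theorem eInt_eq_zpow (m : ℕ) (z : ℤ) :
    eInt m z = Complex.exp (2 * Real.pi * Complex.I / m) ^ z := by
  rw [eInt, ← Complex.exp_int_mul]
  congr 1
  ring

theorem conj_eInt (m : ℕ) (z : ℤ) : (starRingEnd ℂ) (eInt m z) = eInt m (-z) := by
  rw [eInt, eInt, ← Complex.exp_conj]
  congr 1
  simp [Complex.conj_ofNat, neg_div]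

theorem eInt_add (m : ℕ) (y z : ℤ) : eInt m (y + z) = eInt m y * eInt m z := by
  simp only [eInt_eq_zpow]
  exact zpow_add₀ (Complex.exp_ne_zero _) _ _

theorem eInt_natCast_mul (m n : ℕ) (z : ℤ) : eInt m (n * z) = eInt m z ^ n := by
  simp only [eInt_eq_zpow]
  rw [mul_comm (n : ℤ), zpow_mul, zpow_natCast]

theorem norm_eInt (m : ℕ) (z : ℤ) : ‖eInt m z‖ = 1 := by
  have h : 2 * Real.pi * Complex.I * (z : ℂ) / m =
      ((2 * Real.pi * z / m : ℝ) : ℂ) * Complex.I := by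
    push_cast
    ring
  rw [eInt, h, Complex.norm_exp_ofReal_mul_I]

theorem eInt_eq_of_dvd_sub {m : ℕ} (hm : m ≠ 0) {y z : ℤ} (h : (m : ℤ) ∣ y - z) :
    eInt m y = eInt m z := by
  have hone : eInt m (y - z) = 1 := by
    rw [eInt_eq_zpow]
    exact ((Complex.isPrimitiveRoot_exp m hm).zpow_eq_one_iff_dvd _).2 h
  rw [← sub_add_cancel y z, eInt_add, hone, one_mul]

theorem eInt_fin_injective {m : ℕ} (hm : m ≠ 0) :
    Function.Injective fun k : Fin m => eInt m k.val := by
  intro k l h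
  simp only [eInt_eq_zpow, zpow_natCast] at h
  exact Fin.ext ((Complex.isPrimitiveRoot_exp m hm).pow_inj k.isLt l.isLt h)

/-- On a cyclic diagonal `x = y + k` of an odd-order cyclic group, the integer `x + y`
determines the position. -/
theorem Fin.val_add_add_val_injective {p : ℕ} (hp : Odd p) (k : Fin p) :
    Function.Injective fun y : Fin p => (y + k).val + y.val := by
  intro y z h
  have hk := k.isLt
  have hy := y.isLt
  have hz := z.isLt
  obtain ⟨q, hq⟩ := hp
  simp only [Fin.val_add_eq_ite] at h
  ext
  split_ifs at h <;> omega

theorem eInt_sq_sub_sq_node_injective {p : ℕ} (hp : Odd p) {r : ℝ} (hr0 : 0 < r)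
    (hr1 : r < 1) (k : Fin p) :
    Function.Injective fun y : Fin p =>
      (r : ℂ) ^ ((y + k).val + y.val) * eInt p ((y + k).val ^ 2 - y.val ^ 2) := by
  intro y z h
  have hn := congrArg norm h
  simp only [norm_mul, norm_pow, norm_eInt, mul_one, Complex.norm_real, Real.norm_eq_abs,
    abs_of_pos hr0] at hn
  exact Fin.val_add_add_val_injective hp k (pow_right_injective₀ hr0 hr1.ne hn)

theorem perturbed_entry_eq (p a b x y : ℕ) (c r : ℝ) :
    ((c : ℂ) * (r : ℂ) ^ (a * x) * eInt p (a * x ^ 2 + b * x)) *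
      (starRingEnd ℂ) ((c : ℂ) * (r : ℂ) ^ (a * y) * eInt p (a * y ^ 2 + b * y)) =
    (c : ℂ) ^ 2 * eInt p (x - y) ^ b *
      ((r : ℂ) ^ (x + y) * eInt p (x ^ 2 - y ^ 2)) ^ a := by
  have h : eInt p (a * x ^ 2 + b * x) * eInt p (-(a * y ^ 2 + b * y)) =
      eInt p (x - y) ^ b * eInt p (x ^ 2 - y ^ 2) ^ a := by
    rw [← eInt_natCast_mul, ← eInt_natCast_mul, ← eInt_add, ← eInt_add]
    congr 1
    ring
  simp only [map_mul, map_pow, Complex.conj_ofReal, conj_eInt]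
  rw [mul_pow, ← pow_mul]
  linear_combination (c : ℂ) ^ 2 * (r : ℂ) ^ (a * x + a * y) * h

/-- For an odd prime `p`, `0 < r < 1`, and the perturbed vectors
`φ_{a,b} = c_a (r^{a·x} e_p(a x² + b x))_{x=0}^{p−1}` with
`c_a = (Σ_x r^{2 a x})^{-1/2}`, the `p²` matrices `E_{a,b} = |φ_{a,b}⟩⟨φ_{a,b}|/p`
are linearly independent. -/
theorem perturbed_mub_projectors_linearIndependent
    (p : ℕ) (hp : p.Prime) (hodd : p ≠ 2) (r : ℝ) (hr0 : 0 < r) (hr1 : r < 1)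
    (c : Fin p → ℝ)
    (hc : ∀ a, c a = 1 / Real.sqrt (∑ x : Fin p, r ^ (2 * a.val * x.val)))
    (φ : Fin p → Fin p → EuclideanSpace ℂ (Fin p))
    (hφ : ∀ a b x, φ a b x =
      (c a : ℂ) * (r : ℂ) ^ (a.val * x.val) *
        eInt p (a.val * x.val ^ 2 + b.val * x.val)) :
    LinearIndependent ℂ (fun ab : Fin p × Fin p =>
      ((p : ℂ)⁻¹ •
        (Matrix.of fun x y => φ ab.1 ab.2 x * (starRingEnd ℂ) (φ ab.1 ab.2 y)) :
        Matrix (Fin p) (Fin p) ℂ)) := by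
  have hp0 : p ≠ 0 := hp.ne_zero
  have : NeZero p := ⟨hp0⟩
  have hc0 : ∀ a, c a ≠ 0 := by
    intro a
    rw [hc]
    have hpos : 0 < ∑ x : Fin p, r ^ (2 * a.val * x.val) :=
      Finset.sum_pos (fun x _ => pow_pos hr0 _) Finset.univ_nonempty
    positivity
  rw [Fintype.linearIndependent_iff]
  intro d hd
  have hdiag : ∀ k a : Fin p, (c a : ℂ) ^ 2 * ∑ b, d (a, b) * eInt p k.val ^ b.val = 0 := by
    intro k
    refine congrFun (Matrix.eq_zero_of_forall_index_sum_mul_pow_eq_zero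
      (eInt_sq_sub_sq_node_injective (hp.odd_of_ne_two hodd) hr0 hr1 k) fun y => ?_)
    have hshift : eInt p ((y + k).val - y.val) = eInt p k.val := by
      apply eInt_eq_of_dvd_sub hp0
      have hval := Fin.val_add_eq_ite y k
      split_ifs at hval
      · exact ⟨-1, by omega⟩
      · exact ⟨0, by omega⟩
    have hentry := congrFun (congrFun hd (y + k)) y
    simp only [Matrix.sum_apply, Matrix.smul_apply, Matrix.of_apply, Matrix.zero_apply,
      smul_eq_mul, hφ, perturbed_entry_eq, hshift, Fintype.sum_prod_type] at hentry
    have hpC : (p : ℂ)⁻¹ ≠ 0 := inv_ne_zero (Nat.cast_ne_zero.2 hp0)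
    refine (mul_eq_zero.1 (Eq.trans ?_ hentry)).resolve_left hpC
    simp only [Finset.mul_sum, Finset.sum_mul]
    refine Finset.sum_congr rfl fun a _ => Finset.sum_congr rfl fun b _ => ?_
    ring
  rintro ⟨a, b⟩
  refine congrFun (Matrix.eq_zero_of_forall_index_sum_mul_pow_eq_zero
    (v := fun b => d (a, b)) (eInt_fin_injective hp0) fun k => ?_) b
  exact (mul_eq_zero.1 (hdiag k a)).resolve_left
    (pow_ne_zero 2 (Complex.ofReal_ne_zero.2 (hc0 a)))
end
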